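/- Let $\pi$ be a set of primes and let $G$ be any group. If the quotient $G/Z(G)$ of $G$ by its center is a locally (finite $\pi$-)group, then the derived subgroup $G'$ is a locally (finite $\pi$-)group. -/

import Mathlib

/-- finite π-group -/
def IsFinitePiGroup (π : Set ℕ) (G : Type*) [Group G] : Prop :=
  Finite G ∧ ∀ p : ℕ, p.Prime → p ∣ Nat.card G → p ∈ π

/-- locally (finite π)-group -/
def IsLocallyFinitePiGroup (π : Set ℕ) (G : Type*) [Group G] : Prop :=
  ∀ S : Subgroup G, S.FG → IsFinitePiGroup π ↥S

open Subgroup in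
theorem finite_commutatorSet_of_finiteIndex_center (G : Type*) [Group G] [(center G).FiniteIndex] :
    Finite (commutatorSet G) := by
  let c : (G ⧸ center G) × (G ⧸ center G) → G := fun q => q.1.out * q.2.out * q.1.out⁻¹ * q.2.out⁻¹
  refine ((Set.finite_range c).subset ?_).to_subtype
  rintro _ ⟨a, b, rfl⟩
  refine ⟨(a, b), ?_⟩
  obtain ⟨⟨y, hy⟩, hy'⟩ := QuotientGroup.mk_out_eq_mul (center G) a
  obtain ⟨⟨z, hz⟩, hz'⟩ := QuotientGroup.mk_out_eq_mul (center G) b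
  simp only [c, hy', hz']
  rw [mem_center_iff] at hy hz
  simp only [commutatorElement_def, mul_inv_rev]
  calc a * y * (b * z) * (y⁻¹ * a⁻¹) * (z⁻¹ * b⁻¹)
      = a * (y * (b * z)) * (y⁻¹ * a⁻¹) * (z⁻¹ * b⁻¹) := by group
    _ = a * b * (z * a⁻¹) * (z⁻¹ * b⁻¹) := by rw [← hy]; group
    _ = a * b * a⁻¹ * b⁻¹ := by rw [← hz]; group

theorem IsFinitePiGroup.of_card_dvd_pow {π : Set ℕ} {G K : Type*} [Group G] [Group K]
    (hG : IsFinitePiGroup π G) [Finite K] {n : ℕ} (h : Nat.card K ∣ Nat.card G ^ n) :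
    IsFinitePiGroup π K :=
  ⟨inferInstance, fun p hp hd => hG.2 p hp (hp.dvd_of_dvd_pow (hd.trans h))⟩

open Subgroup in
/-- Schur's theorem, for finite `π`-groups. -/
theorem IsFinitePiGroup.commutator {π : Set ℕ} {G : Type*} [Group G]
    (h : IsFinitePiGroup π (G ⧸ center G)) : IsFinitePiGroup π (commutator G) := by
  have := h.1
  have : (center G).FiniteIndex := finiteIndex_of_finite_quotient
  have := finite_commutatorSet_of_finiteIndex_center G
  exact h.of_card_dvd_pow (card_commutator_dvd_index_center_pow G)

theorem IsFinitePiGroup.of_injective {π : Set ℕ} {G K : Type*} [Group G] [Group K]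
    (hG : IsFinitePiGroup π G) (f : K →* G) (hf : Function.Injective f) :
    IsFinitePiGroup π K := by
  have := hG.1
  have := Finite.of_injective f hf
  refine hG.of_card_dvd_pow (n := 1) ?_
  simpa using Subgroup.card_dvd_of_injective f hf

theorem IsFinitePiGroup.of_surjective {π : Set ℕ} {G K : Type*} [Group G] [Group K]
    (hG : IsFinitePiGroup π G) (f : G →* K) (hf : Function.Surjective f) :
    IsFinitePiGroup π K := by
  have := hG.1
  have := Finite.of_surjective f hf
  refine hG.of_card_dvd_pow (n := 1) ?_
  simpa using Subgroup.card_dvd_of_surjective f hf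

theorem Subgroup.FG.map {G K : Type*} [Group G] [Group K] {H : Subgroup G} (hH : H.FG)
    (f : G →* K) : (H.map f).FG := by
  classical
  obtain ⟨T, rfl⟩ := hH
  exact ⟨T.image f, by rw [Finset.coe_image, MonoidHom.map_closure]⟩

open Subgroup in
theorem Subgroup.exists_fg_mem_commutator {G : Type*} [Group G] {x : G}
    (hx : x ∈ _root_.commutator G) : ∃ H : Subgroup G, H.FG ∧ x ∈ ⁅H, H⁆ := by
  rw [commutator_eq_closure] at hx
  induction hx using closure_induction with
  | mem x hx =>
    obtain ⟨a, b, rfl⟩ := hx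
    exact ⟨closure {a, b}, (fg_iff _).2 ⟨_, rfl, Set.toFinite _⟩,
      commutator_mem_commutator (subset_closure (by simp)) (subset_closure (by simp))⟩
  | one => exact ⟨⊥, FG.bot, one_mem _⟩
  | mul x y _ _ hx hy =>
    obtain ⟨H, hH, hx⟩ := hx
    obtain ⟨K, hK, hy⟩ := hy
    exact ⟨H ⊔ K, hH.sup hK, mul_mem (commutator_mono le_sup_left le_sup_left hx)
      (commutator_mono le_sup_right le_sup_right hy)⟩
  | inv x _ hx =>
    obtain ⟨H, hH, hx⟩ := hx
    exact ⟨H, hH, inv_mem hx⟩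

open Subgroup in
theorem Subgroup.FG.exists_fg_le_commutator {G : Type*} [Group G] {S : Subgroup G} (hS : S.FG)
    (hle : S ≤ _root_.commutator G) : ∃ H : Subgroup G, H.FG ∧ S ≤ ⁅H, H⁆ := by
  classical
  obtain ⟨T, rfl⟩ := hS
  induction T using Finset.induction_on with
  | empty => exact ⟨⊥, FG.bot, by simp⟩
  | insert x T _ ih =>
    rw [closure_le, Finset.coe_insert, Set.insert_subset_iff] at hle
    obtain ⟨H, hH, hx⟩ := exists_fg_mem_commutator hle.1
    obtain ⟨K, hK, hT⟩ := ih ((closure_le _).2 hle.2)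
    refine ⟨H ⊔ K, hH.sup hK, ?_⟩
    rw [closure_le, Finset.coe_insert, Set.insert_subset_iff]
    exact ⟨commutator_mono le_sup_left le_sup_left hx,
      ((closure_le _).1 hT).trans (commutator_mono le_sup_right le_sup_right)⟩

open Subgroup in
/-- The quotient of `H` by its own center is a quotient of the image of `H` in `G ⧸ center G`. -/
theorem IsFinitePiGroup.quotient_center_of_map {π : Set ℕ} {G : Type*} [Group G] {H : Subgroup G}
    (h : IsFinitePiGroup π (H.map (QuotientGroup.mk' (center G)))) :
    IsFinitePiGroup π (H ⧸ center H) := by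
  let f := (QuotientGroup.mk' (center G)).subgroupMap H
  have hf : Function.Surjective f := MonoidHom.subgroupMap_surjective _ _
  have hker : f.ker ≤ (QuotientGroup.mk' (center H)).ker := by
    intro x hx
    have hx' : (x : G) ∈ center G :=
      (QuotientGroup.eq_one_iff _).1 (congrArg Subtype.val (MonoidHom.mem_ker.1 hx))
    rw [QuotientGroup.ker_mk', mem_center_iff]
    exact fun y => Subtype.ext (mem_center_iff.1 hx' y)
  refine h.of_surjective (f.liftOfSurjective hf ⟨QuotientGroup.mk' (center H), hker⟩) fun q => ?_
  obtain ⟨x, rfl⟩ := QuotientGroup.mk'_surjective _ q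
  exact ⟨f x, f.liftOfRightInverse_comp_apply _ _ ⟨_, hker⟩ x⟩

/-- **Lemma 3.1.** If `G/Z(G)` is a locally (finite `π`-)group then so is `G'`. -/
theorem derived_isLocallyFinitePi {G : Type*} [Group G] (π : Set ℕ)
    (h : IsLocallyFinitePiGroup π (G ⧸ Subgroup.center G)) :
    IsLocallyFinitePiGroup π ↥(commutator G) := by
  intro S hS
  obtain ⟨H, hH, hle⟩ := (hS.map (commutator G).subtype).exists_fg_le_commutator
    (Subgroup.map_subtype_le S)
  have hH' : IsFinitePiGroup π (commutator H) :=
    (h _ (hH.map (QuotientGroup.mk' (Subgroup.center G)))).quotient_center_of_map.commutator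
  have hmap : IsFinitePiGroup π (⁅H, H⁆ : Subgroup G) := by
    rw [← Subgroup.map_subtype_commutator]
    exact hH'.of_surjective _ (H.subtype.subgroupMap_surjective (commutator H))
  let e := S.equivMapOfInjective _ (commutator G).subtype_injective
  exact hmap.of_injective ((Subgroup.inclusion hle).comp e.toMonoidHom)
    ((Subgroup.inclusion_injective hle).comp e.injective)
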